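/- (Finite-difference formula for the blocked loop Hafnian.) Let M ≥ 1, let A ∈ ℂ^{2M×2M} be symmetric, let γ ∈ ℂ^{2M}, let Λ = {Λ_1,…,Λ_L} be a set partition of {1,…,M}, let b ∈ ℕ^L and N = b_1+⋯+b_L. Define z̄ ∈ ℂ^M by z̄_i = w_j whenever i ∈ Λ_j, and regard f_N(A,γ,z̄) as a polynomial in the variables w_1,…,w_L. Then for any choices of complex parameters u_j ≠ v_j, lhaf_Λ(A, γ, b) = (Π_{j=1}^L D_{w_j}^{(b_j)}) f_N(A, γ, z̄). -/

import Mathlib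

open Matrix

noncomputable section

/-- The loop Hafnian of a matrix `B`: the sum over all involutions `σ` of `{0,…,d-1}`
of the product over `i ≤ σ i` of `B i (σ i)`. -/
def lhaf {d : ℕ} (B : Matrix (Fin d) (Fin d) ℂ) : ℂ :=
  ∑ σ ∈ Finset.univ.filter (fun σ : Equiv.Perm (Fin d) => σ * σ = 1),
    ∏ i ∈ Finset.univ.filter (fun i => i ≤ σ i), B i (σ i)

/-- `filldiag A γ` is `A` with its diagonal overwritten by the entries of `γ`. -/
def filldiag {d : ℕ} (A : Matrix (Fin d) (Fin d) ℂ) (γ : Fin d → ℂ) :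
    Matrix (Fin d) (Fin d) ℂ :=
  Matrix.of fun i j => if i = j then γ i else A i j

/-- `lhaf(A, γ) := lhaf(filldiag(A, γ))`. -/
def lhafv {d : ℕ} (A : Matrix (Fin d) (Fin d) ℂ) (γ : Fin d → ℂ) : ℂ :=
  lhaf (filldiag A γ)

/-- The list containing `n k` consecutive copies of `k`, for `k = 0, 1, …, M-1` in order. -/
def repList {M : ℕ} (n : Fin M → ℕ) : List (Fin M) :=
  (List.finRange M).flatMap fun k => List.replicate (n k) k

lemma repList_length {M : ℕ} (n : Fin M → ℕ) : (repList n).length = ∑ k, n k := by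
  simp only [repList, List.length_flatMap, Fin.sum_univ_def, List.map_map]
  congr 1
  simp [Function.comp]

/-- The repetition map sending each of the `∑ k, n k` indices to the original index of
which it is a copy (`n k` copies of `k`, in order). -/
def rep {M : ℕ} (n : Fin M → ℕ) (i : Fin (∑ k, n k)) : Fin M :=
  (repList n).get (Fin.cast (repList_length n).symm i)

/-- The doubled repetition map: the first `∑ k, n k` indices are copies of the "left"
indices (`n k` copies of `inl k`), the last `∑ k, m k` are copies of the "right" indices
(`m k` copies of `inr k`). -/
def dbl {M : ℕ} (n m : Fin M → ℕ) :
    Fin ((∑ k, n k) + (∑ k, m k)) → Fin M ⊕ Fin M :=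
  (Sum.map (rep n) (rep m)) ∘ finSumFinEquiv.symm

/-- `A_{n⊕m}`: the matrix obtained from a `2M × 2M` matrix `A` (indexed by
`Fin M ⊕ Fin M`) by taking `n k` copies of the `k`-th row/column and `m k` copies of the
`(M+k)`-th row/column. -/
def repMat {M : ℕ} (A : Matrix (Fin M ⊕ Fin M) (Fin M ⊕ Fin M) ℂ) (n m : Fin M → ℕ) :
    Matrix (Fin ((∑ k, n k) + (∑ k, m k))) (Fin ((∑ k, n k) + (∑ k, m k))) ℂ :=
  A.submatrix (dbl n m) (dbl n m)

/-- `γ_{n⊕m}`: the vector obtained from `γ` by taking `n k` copies of the `k`-th entry and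
`m k` copies of the `(M+k)`-th entry. -/
def repVec {M : ℕ} (γ : Fin M ⊕ Fin M → ℂ) (n m : Fin M → ℕ) :
    Fin ((∑ k, n k) + (∑ k, m k)) → ℂ :=
  γ ∘ dbl n m

/-- The swap matrix `X = [[0, I],[I, 0]]`. -/
def Xmat (ι : Type*) [DecidableEq ι] [Fintype ι] (R : Type*) [CommRing R] :
    Matrix (ι ⊕ ι) (ι ⊕ ι) R :=
  Matrix.fromBlocks 0 1 1 0

/-- `D(z) = diag(z) ⊕ diag(z)`. -/
def Dmat {ι : Type*} [DecidableEq ι] {R : Type*} [CommRing R] (z : ι → R) :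
    Matrix (ι ⊕ ι) (ι ⊕ ι) R :=
  Matrix.diagonal (Sum.elim z z)

/-- `g_k(A,γ,z) = tr((D(z)XA)^k)/(2k) + (1/2)·γᵀ (D(z)XA)^{k-1} D(z)X γ`. -/
def gfun {ι : Type*} [Fintype ι] [DecidableEq ι] {R : Type*} [CommRing R]
    (A : Matrix (ι ⊕ ι) (ι ⊕ ι) R) (γ : ι ⊕ ι → R) (z : ι → R) (k : ℕ) : R :=
  Ring.inverse ((2 * k : ℕ) : R) * Matrix.trace ((Dmat z * Xmat ι R * A) ^ k)
    + Ring.inverse (2 : R) *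
        (γ ⬝ᵥ Matrix.mulVec ((Dmat z * Xmat ι R * A) ^ (k - 1) * (Dmat z * Xmat ι R)) γ)

/-- `f_N(A,γ,z)`: the coefficient of `η^N` in `Σ_{j=0}^N (1/j!)(Σ_{k=1}^N g_k(A,γ,z) η^k)^j`. -/
def fN {ι : Type*} [Fintype ι] [DecidableEq ι] {R : Type*} [CommRing R]
    (N : ℕ) (A : Matrix (ι ⊕ ι) (ι ⊕ ι) R) (γ : ι ⊕ ι → R) (z : ι → R) : R :=
  Polynomial.coeff
    (∑ j ∈ Finset.range (N + 1),
      Polynomial.C (Ring.inverse ((j.factorial : ℕ) : R)) *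
        (∑ k ∈ Finset.Icc 1 N, Polynomial.C (gfun A γ z k) * Polynomial.X ^ k) ^ j) N

/-- The set `K_Λ^b` of detection patterns compatible with the coarse-grained pattern `b`,
for the set partition of `Fin M` whose blocks are the fibers of the (surjective) labeling
map `π : Fin M → Fin L`. -/
def Kset {M L : ℕ} (π : Fin M → Fin L) (b : Fin L → ℕ) : Finset (Fin M → ℕ) :=
  (Fintype.piFinset fun _ : Fin M => Finset.range ((∑ j, b j) + 1)).filter
    (fun n => ∀ j, ∑ i ∈ Finset.univ.filter (fun i => π i = j), n i = b j)

/-- The `Λ`-blocked loop Hafnian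
`lhaf_Λ(A,γ,b) := (Π_j b_j!) · Σ_{n ∈ K_Λ^b} lhaf(A_{n⊕n}, γ_{n⊕n}) / Π_i n_i!`. -/
def lhafB {M L : ℕ} (π : Fin M → Fin L)
    (A : Matrix (Fin M ⊕ Fin M) (Fin M ⊕ Fin M) ℂ) (γ : Fin M ⊕ Fin M → ℂ)
    (b : Fin L → ℕ) : ℂ :=
  (∏ j, ((b j).factorial : ℂ)) *
    ∑ n ∈ Kset π b,
      lhafv (repMat A n n) (repVec γ n n) / ∏ i, ((n i).factorial : ℂ)

/-- Substitute the constant `c` for the variable `j` in a multivariate polynomial,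
leaving the other variables untouched. -/
def substVar {L : ℕ} (j : Fin L) (c : ℂ) (P : MvPolynomial (Fin L) ℂ) :
    MvPolynomial (Fin L) ℂ :=
  MvPolynomial.aeval (fun i => if i = j then MvPolynomial.C c else MvPolynomial.X i) P

/-- The `k`-th finite-difference operator in the variable `j`, with parameters `u ≠ v`:
`D_{w_j}^{(k)} P = (u − v)^{−k} Σ_{m=0}^{k} C(k,m) (−1)^{k−m} P|_{w_j = v + m(u − v)}`. -/
def fdiff {L : ℕ} (j : Fin L) (k : ℕ) (u v : ℂ) (P : MvPolynomial (Fin L) ℂ) :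
    MvPolynomial (Fin L) ℂ :=
  MvPolynomial.C (((u - v) ^ k)⁻¹) *
    ∑ m ∈ Finset.range (k + 1),
      MvPolynomial.C ((Nat.choose k m : ℂ) * (-1) ^ (k - m)) *
        substVar j (v + (m : ℂ) * (u - v)) P

section WickFunctional

open MvPolynomial

variable {V : Type*} [Fintype V] [DecidableEq V] {R : Type*} [CommRing R]

/-- First order operator `∑ b, A a b ∂_b + γ a`. -/
def eOp (A : Matrix V V R) (γ : V → R) (a : V) : Module.End R (MvPolynomial V R) :=
  ∑ b, A a b • (pderiv b).toLinearMap + γ a • LinearMap.id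

/-- Second order operator `½ ∂ᵀ A ∂ + γᵀ ∂`. -/
def lapOp (A : Matrix V V R) (γ : V → R) : Module.End R (MvPolynomial V R) :=
  ∑ a, ((Ring.inverse (2 : R)) • (∑ b, A a b • ((pderiv a).toLinearMap * (pderiv b).toLinearMap))
    + γ a • (pderiv a).toLinearMap)

lemma pderiv_comm_op (a b : V) :
    ((pderiv a).toLinearMap * (pderiv b).toLinearMap : Module.End R (MvPolynomial V R))
      = (pderiv b).toLinearMap * (pderiv a).toLinearMap := by
  have h : ⁅(pderiv a : Derivation R (MvPolynomial V R) (MvPolynomial V R)),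
      (pderiv b : Derivation R (MvPolynomial V R) (MvPolynomial V R))⁆ = 0 := by
    apply MvPolynomial.derivation_ext
    intro i
    have h1 : ∀ c d : V, pderiv c (pderiv d (X i : MvPolynomial V R)) = 0 := by
      intro c d
      rw [pderiv_X, Pi.single_apply]
      split_ifs <;> simp
    rw [Derivation.commutator_apply, h1, h1]
    simp
  refine LinearMap.ext fun p => ?_
  have := congrArg (fun D => D p) h
  simp only [Derivation.commutator_apply, Derivation.coe_zero, Pi.zero_apply, sub_eq_zero] at this
  exact this

lemma commute_e_lap (A : Matrix V V R) (γ : V → R) (a : V) :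
    Commute (lapOp A γ) (eOp A γ a) := by
  have hc : ∀ a b : V, Commute ((pderiv a).toLinearMap : Module.End R (MvPolynomial V R))
      ((pderiv b).toLinearMap) := fun a b => pderiv_comm_op a b
  unfold lapOp eOp
  refine Commute.sum_left _ _ _ fun i _ => ?_
  refine Commute.add_right (Commute.sum_right _ _ _ fun j _ => ?_) ?_
  · refine Commute.smul_right ?_ _
    refine Commute.add_left (Commute.smul_left (Commute.sum_left _ _ _ fun k _ => ?_) _)
      ((hc _ _).smul_left _)
    exact ((hc _ _).mul_left (hc _ _)).smul_left _
  · exact (Commute.one_right _).smul_right _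

lemma lap_X_mul (h2 : (2 : R) * Ring.inverse (2 : R) = 1)
    (A : Matrix V V R) (hA : A.IsSymm) (γ : V → R) (a : V)
    (p : MvPolynomial V R) :
    lapOp A γ (X a * p) = X a * lapOp A γ p + eOp A γ a p := by
  have e1 : ∀ i : V, ∀ q : MvPolynomial V R, pderiv i (X a * q)
      = X a * pderiv i q + if i = a then q else 0 := by
    intro i q
    rw [pderiv_mul, pderiv_X]
    by_cases h : i = a
    · subst h; simp [add_comm]
    · simp [h, Ne.symm h]
  have e2 : ∀ i j : V, pderiv i (pderiv j (X a * p))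
      = X a * pderiv i (pderiv j p) + (if i = a then pderiv j p else 0)
        + (if j = a then pderiv i p else 0) := by
    intro i j
    rw [e1, map_add, e1]
    congr 1
    split_ifs <;> simp
  simp only [lapOp, eOp, LinearMap.sum_apply, LinearMap.add_apply, LinearMap.smul_apply,
    Module.End.mul_apply, Derivation.coeFn_coe, LinearMap.id_apply, e2]
  simp only [e1, smul_add,
    Finset.sum_add_distrib, Finset.mul_sum, mul_add, mul_smul_comm, smul_ite, smul_zero,
    Finset.sum_ite_eq', Finset.mem_univ, if_true, Finset.smul_sum]
  have s1 : ∑ x, ∑ i, (if x = a then Ring.inverse (2 : R) • A x i • pderiv i p else 0)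
      = ∑ i, Ring.inverse (2 : R) • A a i • pderiv i p := by
    rw [Finset.sum_comm]
    simp
  have s2 : ∑ i, A a i • pderiv i p = ∑ i, Ring.inverse (2 : R) • A a i • pderiv i p
      + ∑ i, Ring.inverse (2 : R) • A i a • pderiv i p := by
    rw [← Finset.sum_add_distrib]
    refine Finset.sum_congr rfl fun i _ => ?_
    rw [hA.apply a i, smul_smul, ← add_smul]
    congr 1
    linear_combination (-A a i) * h2
  rw [s1, s2]
  abel

lemma lap_pow_X_mul (h2 : (2 : R) * Ring.inverse (2 : R) = 1)
    (A : Matrix V V R) (hA : A.IsSymm) (γ : V → R) (a : V)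
    (p : MvPolynomial V R) (k : ℕ) :
    (lapOp A γ ^ k) (X a * p) = X a * (lapOp A γ ^ k) p
      + (k : R) • (lapOp A γ ^ (k - 1)) (eOp A γ a p) := by
  induction k generalizing p with
  | zero => simp
  | succ k ih =>
    rw [pow_succ, Module.End.mul_apply, lap_X_mul h2 A hA, map_add, ih]
    have := (commute_e_lap A γ a)
    have h3 : eOp A γ a (lapOp A γ p) = lapOp A γ (eOp A γ a p) :=
      (congrArg (fun f => f p) this).symm
    rw [h3]
    cases k with
    | zero => simp
    | succ k =>
      simp only [Nat.add_sub_cancel, pow_succ, Module.End.mul_apply]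
      push_cast
      module

lemma lap_nilp (h2 : (2 : R) * Ring.inverse (2 : R) = 1)
    (A : Matrix V V R) (hA : A.IsSymm) (γ : V → R) (p : MvPolynomial V R) :
    ∃ K, ∀ k, K ≤ k → (lapOp A γ ^ k) p = 0 := by
  induction p using MvPolynomial.induction_on with
  | C c =>
    refine ⟨1, fun k hk => ?_⟩
    obtain ⟨k, rfl⟩ := Nat.exists_eq_add_of_le' hk
    rw [pow_succ, Module.End.mul_apply]
    have : lapOp A γ (C c) = 0 := by
      simp [lapOp, LinearMap.sum_apply]
    rw [this, map_zero]
  | add p q hp hq =>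
    obtain ⟨K, hK⟩ := hp
    obtain ⟨K', hK'⟩ := hq
    exact ⟨max K K', fun k hk => by
      rw [map_add, hK k (le_trans (le_max_left _ _) hk), hK' k (le_trans (le_max_right _ _) hk),
        add_zero]⟩
  | mul_X p a hp =>
    obtain ⟨K, hK⟩ := hp
    refine ⟨K + 1, fun k hk => ?_⟩
    rw [mul_comm, lap_pow_X_mul h2 A hA, hK k (by omega)]
    have h3 : (lapOp A γ ^ (k-1)) (eOp A γ a p) = eOp A γ a ((lapOp A γ ^ (k-1)) p) :=
      (congrArg (fun f => f p) ((commute_e_lap A γ a).pow_left (k-1)))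
    rw [h3, hK (k-1) (by omega)]
    simp

/-- The Wick functional. -/
def wickFun (A : Matrix V V R) (γ : V → R) (p : MvPolynomial V R) : R :=
  ∑ᶠ k : ℕ, Ring.inverse ((k.factorial : ℕ) : R) * constantCoeff ((lapOp A γ ^ k) p)

lemma wickFun_eq (A : Matrix V V R) (γ : V → R) (p : MvPolynomial V R) (K : ℕ)
    (hK : ∀ k, K ≤ k → (lapOp A γ ^ k) p = 0) :
    wickFun A γ p = ∑ k ∈ Finset.range K,
      Ring.inverse ((k.factorial : ℕ) : R) * constantCoeff ((lapOp A γ ^ k) p) := by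
  apply finsum_eq_sum_of_support_subset
  intro k hk
  by_contra h
  apply hk
  simp only [Finset.coe_range, Set.mem_Iio, not_lt] at h
  simp [hK k h]

lemma exists_wick (hR : ∀ n : ℕ, n ≠ 0 → (n : R) * Ring.inverse (n : R) = 1)
    (A : Matrix V V R) (hA : A.IsSymm) (γ : V → R) :
    ∃ Λ : MvPolynomial V R →ₗ[R] R, Λ 1 = 1 ∧
      ∀ a p, Λ (X a * p) = γ a * Λ p + ∑ b, A a b * Λ (pderiv b p) := by
  have h2 : (2 : R) * Ring.inverse (2 : R) = 1 := by simpa using hR 2 (by norm_num)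
  let Λ : MvPolynomial V R →ₗ[R] R :=
    { toFun := wickFun A γ
      map_add' := by
        intro p q
        obtain ⟨K, hK⟩ := lap_nilp h2 A hA γ p
        obtain ⟨K', hK'⟩ := lap_nilp h2 A hA γ q
        rw [wickFun_eq A γ p (max K K') (fun k hk => hK k (le_trans (le_max_left _ _) hk)),
          wickFun_eq A γ q (max K K') (fun k hk => hK' k (le_trans (le_max_right _ _) hk)),
          wickFun_eq A γ (p + q) (max K K') (fun k hk => by
            rw [map_add, hK k (le_trans (le_max_left _ _) hk),
              hK' k (le_trans (le_max_right _ _) hk), add_zero]), ← Finset.sum_add_distrib]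
        simp [mul_add]
      map_smul' := by
        intro c p
        obtain ⟨K, hK⟩ := lap_nilp h2 A hA γ p
        rw [wickFun_eq A γ p K hK, wickFun_eq A γ (c • p) K (fun k hk => by
          rw [map_smul, hK k hk, smul_zero]), RingHom.id_apply, Finset.smul_sum]
        refine Finset.sum_congr rfl fun k _ => ?_
        rw [map_smul, MvPolynomial.smul_eq_C_mul, map_mul, constantCoeff_C, smul_eq_mul]
        ring }
  have hΛ : ∀ p, Λ p = wickFun A γ p := fun p => rfl
  refine ⟨Λ, ?_, ?_⟩
  · rw [hΛ, wickFun_eq A γ 1 1]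
    · simp
    · intro k hk
      obtain ⟨k, rfl⟩ := Nat.exists_eq_add_of_le' hk
      rw [pow_succ, Module.End.mul_apply]
      have : lapOp A γ 1 = 0 := by
        simp [lapOp, LinearMap.sum_apply]
      rw [this, map_zero]
  · intro a p
    have key : Λ (X a * p) = Λ (eOp A γ a p) := by
      obtain ⟨K, hK⟩ := lap_nilp h2 A hA γ p
      have hK1 : ∀ k, K ≤ k → (lapOp A γ ^ k) (eOp A γ a p) = 0 := by
        intro k hk
        have h3 : (lapOp A γ ^ k) (eOp A γ a p) = eOp A γ a ((lapOp A γ ^ k) p) :=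
          (congrArg (fun f => f p) ((commute_e_lap A γ a).pow_left k))
        rw [h3, hK k hk, map_zero]
      rw [hΛ, hΛ, wickFun_eq A γ _ K hK1, wickFun_eq A γ (X a * p) (K + 1),
        Finset.sum_range_succ']
      · simp only [lap_pow_X_mul h2 A hA]
        simp only [map_add, map_mul, constantCoeff_X, zero_mul, zero_add, Nat.add_sub_cancel,
          smul_eq_C_mul, constantCoeff_C]
        simp only [Nat.cast_zero, zero_mul, mul_zero, add_zero]
        refine Finset.sum_congr rfl fun k _ => ?_
        rw [← mul_assoc]
        congr 1
        have h4 := hR (k+1).factorial (Nat.factorial_ne_zero _)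
        have h5 := hR k.factorial (Nat.factorial_ne_zero _)
        rw [Nat.factorial_succ] at h4 ⊢
        set x := Ring.inverse (((k+1) * k.factorial : ℕ) : R)
        set y := Ring.inverse ((k.factorial : ℕ) : R)
        push_cast at h4 ⊢
        linear_combination (-x * (k+1)) * h5 + y * h4
      · intro k hk
        rw [lap_pow_X_mul h2 A hA, hK k (by omega), hK1 (k-1) (by omega)]
        simp
    rw [key, eOp, LinearMap.add_apply, LinearMap.sum_apply, map_add, map_sum, add_comm]
    simp
end WickFunctional

section LoopHafnian

variable {R : Type*} [CommRing R]

/-- Involutions supported in `s`. -/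
def invSet {α : Type*} [Fintype α] [DecidableEq α] (s : Finset α) : Finset (Equiv.Perm α) :=
  Finset.univ.filter (fun σ => (∀ i, σ (σ i) = i) ∧ ∀ i, i ∉ s → σ i = i)

/-- Loop Hafnian of the principal submatrix on `s`. -/
def lhafS {α : Type*} [Fintype α] [LinearOrder α] (B : α → α → R) (s : Finset α) : R :=
  ∑ σ ∈ invSet s, ∏ i ∈ s, if i ≤ σ i then B i (σ i) else 1

lemma lhafS_empty {α : Type*} [Fintype α] [LinearOrder α] (B : α → α → R) :
    lhafS B ∅ = 1 := by
  have : invSet (∅ : Finset α) = {1} := by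
    ext σ
    simp only [invSet, Finset.mem_filter, Finset.mem_univ, true_and, Finset.notMem_empty,
      not_false_eq_true, forall_true_left, Finset.mem_singleton]
    constructor
    · rintro ⟨_, h⟩; exact Equiv.ext h
    · rintro rfl; simp
  simp [lhafS, this]

lemma lhafS_insert {α : Type*} [Fintype α] [LinearOrder α] (B : α → α → R)
    (hB : ∀ i j, B i j = B j i) (s : Finset α) (a : α) (ha : a ∉ s) :
    lhafS B (insert a s) = B a a * lhafS B s + ∑ b ∈ s, B a b * lhafS B (s.erase b) := by
  unfold lhafS
  rw [← Finset.sum_fiberwise_of_maps_to (s := invSet (insert a s)) (t := insert a s)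
    (g := fun σ : Equiv.Perm α => σ a)]
  · rw [Finset.sum_insert ha]
    congr 1
    · have : (invSet (insert a s)).filter (fun σ => σ a = a) = invSet s := by
        ext σ
        simp only [invSet, Finset.mem_filter, Finset.mem_univ, true_and, Finset.mem_insert,
          not_or]
        constructor
        · rintro ⟨⟨h1, h2⟩, h3⟩
          refine ⟨h1, fun i hi => ?_⟩
          by_cases h : i = a
          · rw [h, h3]
          · exact h2 i ⟨h, hi⟩
        · rintro ⟨h1, h2⟩
          exact ⟨⟨h1, fun i hi => h2 i hi.2⟩, h2 a ha⟩
      rw [this, Finset.mul_sum]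
      refine Finset.sum_congr rfl fun σ hσ => ?_
      have h3 : σ a = a := by
        simp only [invSet, Finset.mem_filter] at hσ
        exact hσ.2.2 a ha
      rw [Finset.prod_insert ha, h3]
      simp
    · refine Finset.sum_congr rfl fun b hb => ?_
      have hab : a ≠ b := fun h => ha (h ▸ hb)
      rw [Finset.mul_sum]
      refine Finset.sum_nbij' (fun σ => Equiv.swap a b * σ) (fun σ => Equiv.swap a b * σ)
        ?_ ?_ ?_ ?_ ?_
      · intro σ hσ
        simp only [invSet, Finset.mem_filter, Finset.mem_univ, true_and, Finset.mem_insert,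
          not_or, Finset.mem_erase, Equiv.Perm.mul_apply] at hσ ⊢
        obtain ⟨⟨h1, h2⟩, h3⟩ := hσ
        have h4 : σ b = a := by rw [← h3, h1]
        have hsa : ∀ i, σ i = a → i = b := fun i h => by rw [← h1 i, h, h3]
        have hsb : ∀ i, σ i = b → i = a := fun i h => by rw [← h1 i, h, h4]
        constructor
        · intro i
          by_cases hia : i = a
          · subst hia; simp [h3]
          by_cases hib : i = b
          · subst hib; simp [h4]
          rw [Equiv.swap_apply_of_ne_of_ne (a := a) (b := b) (x := σ i)
            (fun h => hib (hsa i h)) (fun h => hia (hsb i h)), h1,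
            Equiv.swap_apply_of_ne_of_ne hia hib]
        · intro i hi
          by_cases hia : i = a
          · subst hia; simp [h3]
          by_cases hib : i = b
          · subst hib; simp [h4]
          rw [h2 i ⟨hia, fun h => hi ⟨hib, h⟩⟩, Equiv.swap_apply_of_ne_of_ne hia hib]
      · intro σ hσ
        simp only [invSet, Finset.mem_filter, Finset.mem_univ, true_and, Finset.mem_insert,
          not_or, Finset.mem_erase, Equiv.Perm.mul_apply] at hσ ⊢
        obtain ⟨h1, h2⟩ := hσ
        have h3 : σ a = a := h2 a (fun h => ha h.2)
        have h4 : σ b = b := h2 b (fun h => h.1 rfl)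
        have hsa : ∀ i, σ i = a → i = a := fun i h => by rw [← h1 i, h, h3]
        have hsb : ∀ i, σ i = b → i = b := fun i h => by rw [← h1 i, h, h4]
        refine ⟨⟨?_, ?_⟩, by simp [h3]⟩
        · intro i
          by_cases hia : i = a
          · subst hia; simp [h3, h4]
          by_cases hib : i = b
          · subst hib; simp [h3, h4]
          rw [Equiv.swap_apply_of_ne_of_ne (a := a) (b := b) (x := σ i)
            (fun h => hia (hsa i h)) (fun h => hib (hsb i h)), h1,
            Equiv.swap_apply_of_ne_of_ne hia hib]
        · intro i hi
          have hib : i ≠ b := fun h => hi.2 (h ▸ hb)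
          rw [h2 i (fun h => hi.2 h.2), Equiv.swap_apply_of_ne_of_ne hi.1 hib]
      · intro σ _; ext i; simp
      · intro σ _; ext i; simp
      · intro σ hσ
        simp only [invSet, Finset.mem_filter, Finset.mem_univ, true_and, Finset.mem_insert,
          not_or] at hσ
        obtain ⟨⟨h1, h2⟩, h3⟩ := hσ
        have h4 : σ b = a := by rw [← h3, h1]
        have hsa : ∀ i, σ i = a → i = b := fun i h => by rw [← h1 i, h, h3]
        have hsb : ∀ i, σ i = b → i = a := fun i h => by rw [← h1 i, h, h4]
        rw [Finset.prod_insert ha, ← Finset.mul_prod_erase s _ hb, h3, h4, ← mul_assoc]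
        congr 1
        · rcases lt_or_gt_of_ne hab with h | h
          · simp [h.le, h.not_ge]
          · simp [h.le, h.not_ge, hB b a]
        · refine Finset.prod_congr rfl fun i hi => ?_
          rw [Finset.mem_erase] at hi
          have hia : i ≠ a := fun h => ha (h ▸ hi.2)
          rw [Equiv.Perm.mul_apply, Equiv.swap_apply_of_ne_of_ne
            (fun h => hi.1 (hsa i h)) (fun h => hia (hsb i h))]
  · intro σ hσ
    simp only [invSet, Finset.mem_filter, Finset.mem_univ, true_and] at hσ
    by_contra h
    have := hσ.2 _ h
    rw [hσ.1] at this
    rw [← this] at h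
    simp at h

lemma lhaf_eq_lhafS {d : ℕ} (B : Matrix (Fin d) (Fin d) ℂ) :
    lhaf B = lhafS B Finset.univ := by
  unfold lhaf lhafS invSet
  refine Finset.sum_congr ?_ fun σ _ => ?_
  · ext σ
    simp [Equiv.ext_iff]
  · rw [Finset.prod_filter]

open MvPolynomial in
lemma pderiv_prod_X {V α : Type*} [DecidableEq V] [DecidableEq α] (φ : α → V) (s : Finset α)
    (b : V) :
    pderiv b (∏ i ∈ s, (X (φ i) : MvPolynomial V R))
      = ∑ j ∈ s, if φ j = b then ∏ i ∈ s.erase j, X (φ i) else 0 := by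
  induction s using Finset.induction_on with
  | empty => simp
  | insert a s ha ih =>
    rw [Finset.prod_insert ha, pderiv_mul, ih, Finset.sum_insert ha, Finset.erase_insert ha,
      pderiv_X, Pi.single_apply, ite_mul, one_mul, zero_mul, Finset.mul_sum]
    congr 1
    refine Finset.sum_congr rfl fun j hj => ?_
    have hja : a ≠ j := fun h => ha (h ▸ hj)
    rw [Finset.erase_insert_of_ne hja, Finset.prod_insert (by simp [ha]), mul_ite, mul_zero]

open MvPolynomial in
lemma lhafS_eq_wick {V α : Type*} [Fintype V] [DecidableEq V] [Fintype α] [LinearOrder α]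
    (A : Matrix V V R) (hA : A.IsSymm) (γ : V → R) (Λ : MvPolynomial V R →ₗ[R] R)
    (h1 : Λ 1 = 1) (hΛ : ∀ a p, Λ (X a * p) = γ a * Λ p + ∑ b, A a b * Λ (pderiv b p))
    (φ : α → V) (n : ℕ) : ∀ (s : Finset α), s.card ≤ n →
    lhafS (fun i j => if i = j then γ (φ i) else A (φ i) (φ j)) s = Λ (∏ i ∈ s, X (φ i)) := by
  induction n with
  | zero =>
    intro s hs
    have : s = ∅ := by simpa using hs
    subst this
    simp [lhafS_empty, h1]
  | succ n ih =>
    intro s hs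
    rcases s.eq_empty_or_nonempty with rfl | ⟨a, ha⟩
    · simp [lhafS_empty, h1]
    obtain ⟨t, hat, rfl⟩ : ∃ t, a ∉ t ∧ insert a t = s :=
      ⟨s.erase a, Finset.notMem_erase _ _, Finset.insert_erase ha⟩
    rw [Finset.card_insert_of_notMem hat] at hs
    rw [lhafS_insert _ _ _ _ hat, Finset.prod_insert hat, hΛ, ih t (by omega)]
    · congr 1
      · simp
      · simp only [pderiv_prod_X, map_sum, Finset.mul_sum]
        rw [Finset.sum_comm]
        refine Finset.sum_congr rfl fun j hj => ?_
        have hja : a ≠ j := fun h => hat (h ▸ hj)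
        rw [ih (t.erase j) (by have := Finset.card_erase_le (s := t) (a := j); omega), if_neg hja]
        rw [Finset.sum_eq_single (φ j)]
        · simp
        · intro b _ hb
          simp [Ne.symm hb]
        · simp
    · intro i j
      by_cases h : i = j
      · subst h; rfl
      · simp only [h, Ne.symm h, if_false]
        exact (hA.apply _ _)

end LoopHafnian

section Recursion

open MvPolynomial

variable {V : Type*} [Fintype V] [DecidableEq V] {R : Type*} [CommRing R]

lemma solve_rec_vec (B : Matrix V V R) (y c : ℕ → V → R) (h0 : y 0 = c 0)
    (hs : ∀ N, y (N + 1) = c (N + 1) + B *ᵥ y N) (N : ℕ) :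
    y N = ∑ p ∈ Finset.HasAntidiagonal.antidiagonal N, (B ^ p.1) *ᵥ c p.2 := by
  induction N with
  | zero => simp [h0]
  | succ N ih =>
    rw [hs, ih, Finset.Nat.sum_antidiagonal_succ, Matrix.mulVec_sum]
    simp [pow_succ']

lemma solve_rec_mat (B : Matrix V V R) (y c : ℕ → Matrix V V R) (h0 : y 0 = c 0)
    (hs : ∀ N, y (N + 1) = c (N + 1) + B * y N) (N : ℕ) :
    y N = ∑ p ∈ Finset.HasAntidiagonal.antidiagonal N, (B ^ p.1) * c p.2 := by
  induction N with
  | zero => simp [h0]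
  | succ N ih =>
    rw [hs, ih, Finset.Nat.sum_antidiagonal_succ, Matrix.mul_sum]
    simp [pow_succ', Matrix.mul_assoc]

lemma sum_anti_assoc (N : ℕ) (φ t : ℕ → R) :
    ∑ p ∈ Finset.HasAntidiagonal.antidiagonal N, ∑ r ∈ Finset.HasAntidiagonal.antidiagonal p.2, t r.2 * φ (r.1 + p.1)
      = ∑ p ∈ Finset.HasAntidiagonal.antidiagonal N, ((p.1 : R) + 1) * φ p.1 * t p.2 := by
  have h : ∀ p ∈ Finset.HasAntidiagonal.antidiagonal N, ((p.1 : R) + 1) * φ p.1 * t p.2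
      = ∑ r ∈ Finset.HasAntidiagonal.antidiagonal p.1, φ p.1 * t p.2 := by
    intro p _
    rw [Finset.sum_const, Finset.Nat.card_antidiagonal, nsmul_eq_mul]
    push_cast
    ring
  rw [Finset.sum_congr rfl h, Finset.sum_sigma', Finset.sum_sigma']
  refine Finset.sum_nbij' (fun x => ⟨(x.2.1 + x.1.1, x.2.2), (x.1.1, x.2.1)⟩)
    (fun x => ⟨(x.2.1, x.2.2 + x.1.2), (x.2.2, x.1.2)⟩) ?_ ?_ ?_ ?_ ?_
  · rintro ⟨⟨a, b⟩, ⟨c, d⟩⟩ h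
    simp only [Finset.mem_sigma, Finset.HasAntidiagonal.mem_antidiagonal] at h ⊢
    obtain ⟨h1, h2⟩ := h
    refine ⟨?_, ?_⟩ <;> (try simp only) <;> omega
  · rintro ⟨⟨a, b⟩, ⟨c, d⟩⟩ h
    simp only [Finset.mem_sigma, Finset.HasAntidiagonal.mem_antidiagonal] at h ⊢
    obtain ⟨h1, h2⟩ := h
    refine ⟨?_, ?_⟩ <;> (try simp only) <;> omega
  · rintro ⟨⟨a, b⟩, ⟨c, d⟩⟩ h
    simp only [Finset.mem_sigma, Finset.HasAntidiagonal.mem_antidiagonal] at h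
    obtain ⟨h1, rfl⟩ := h
    rfl
  · rintro ⟨⟨a, b⟩, ⟨c, d⟩⟩ h
    simp only [Finset.mem_sigma, Finset.HasAntidiagonal.mem_antidiagonal] at h
    obtain ⟨h1, rfl⟩ := h
    simp [add_comm]
  · rintro ⟨⟨a, b⟩, ⟨c, d⟩⟩ h
    simp only
    ring

lemma wick_rec (hR : ∀ n : ℕ, n ≠ 0 → (n : R) * Ring.inverse (n : R) = 1)
    (A W : Matrix V V R) (hA : A.IsSymm) (hW : W.IsSymm) (γ : V → R)
    (Λ : MvPolynomial V R →ₗ[R] R)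
    (hΛ : ∀ a p, Λ (X a * p) = γ a * Λ p + ∑ b, A a b * Λ (pderiv b p))
    (q : MvPolynomial V R) (hq1 : ∀ b, pderiv b q = ∑ c, C (W b c) * X c)
    (hq2 : 2 * q = ∑ b, ∑ c, C (W b c) * (X b * X c))
    (t : ℕ → R) (ht : ∀ N, t N = Ring.inverse ((N.factorial : ℕ) : R) * Λ (q ^ N)) (N : ℕ) :
    2 * ((N : R) + 1) * t (N + 1) = ∑ p ∈ Finset.HasAntidiagonal.antidiagonal N,
      (Matrix.trace ((W * A) ^ (p.1 + 1))
        + ((p.1 : R) + 1) * (γ ⬝ᵥ (((W * A) ^ p.1 * W) *ᵥ γ))) * t p.2 := by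
  have hC : ∀ (c : R) (p : MvPolynomial V R), Λ (C c * p) = c * Λ p := by
    intro c p
    rw [← smul_eq_C_mul, map_smul, smul_eq_mul]
  have hinv : ∀ N : ℕ, ((N : R) + 1) * Ring.inverse (((N + 1).factorial : ℕ) : R)
      = Ring.inverse ((N.factorial : ℕ) : R) := by
    intro k
    have h4 := hR (k+1).factorial (Nat.factorial_ne_zero _)
    have h5 := hR k.factorial (Nat.factorial_ne_zero _)
    rw [Nat.factorial_succ] at h4 ⊢
    set x := Ring.inverse (((k+1) * k.factorial : ℕ) : R)
    set y := Ring.inverse ((k.factorial : ℕ) : R)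
    push_cast at h4 ⊢
    linear_combination (-x * (k+1)) * h5 + y * h4
  set τ : ℕ → MvPolynomial V R → R :=
    fun N p => Ring.inverse ((N.factorial : ℕ) : R) * Λ (p * q ^ N) with hτ
  have τadd : ∀ N p p', τ N (p + p') = τ N p + τ N p' := by
    intro N p p'; simp only [hτ, add_mul, map_add, mul_add]
  have τsum : ∀ N (f : V → MvPolynomial V R), τ N (∑ c, f c) = ∑ c, τ N (f c) := by
    intro N f; simp only [hτ, Finset.sum_mul, map_sum, Finset.mul_sum]
  have τC : ∀ N c p, τ N (C c * p) = c * τ N p := by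
    intro N c p; simp only [hτ, mul_assoc, hC]; ring
  have τ1 : ∀ N, τ N 1 = t N := by
    intro N; simp only [hτ, ht, one_mul]
  have r0 : ∀ a p, τ 0 (X a * p) = γ a * τ 0 p + ∑ b, A a b * τ 0 (pderiv b p) := by
    intro a p
    simp only [hτ, pow_zero, mul_one, hΛ, mul_add, Finset.mul_sum]
    congr 1
    · ring
    · refine Finset.sum_congr rfl fun b _ => by ring
  have r1 : ∀ N a p, τ (N + 1) (X a * p) = γ a * τ (N + 1) p
      + ∑ b, A a b * τ (N + 1) (pderiv b p)
      + ∑ b, ∑ c, A a b * W b c * τ N (X c * p) := by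
    intro N a p
    have e1 : ∀ b, pderiv b (p * q ^ (N + 1)) = pderiv b p * q ^ (N + 1)
        + C ((N : R) + 1) * ∑ c, C (W b c) * (X c * p * q ^ N) := by
      intro b
      rw [pderiv_mul, pderiv_pow, hq1, Finset.mul_sum, Finset.mul_sum, Finset.mul_sum]
      congr 1
      refine Finset.sum_congr rfl fun c _ => ?_
      simp
      ring
    have e2 : ∀ b, Λ (pderiv b (p * q ^ (N + 1))) = Λ (pderiv b p * q ^ (N + 1))
        + ((N : R) + 1) * ∑ c, W b c * Λ (X c * p * q ^ N) := by
      intro b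
      rw [e1, map_add, hC, map_sum]
      simp only [hC]
    simp only [hτ, mul_assoc (X a) p, hΛ, e2, ← hinv N]
    simp only [mul_add, Finset.sum_add_distrib, Finset.mul_sum]
    rw [← add_assoc]
    congr 1
    · congr 1
      · ring
      · refine Finset.sum_congr rfl fun b _ => by ring
    · refine Finset.sum_congr rfl fun b _ => Finset.sum_congr rfl fun c _ => ?_
      ring
  -- moments
  set m : ℕ → V → R := fun N a => τ N (X a) with hm
  set S : ℕ → Matrix V V R := fun N => Matrix.of fun a c => τ N (X a * X c) with hS
  have hm0 : m 0 = t 0 • γ := by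
    ext a
    have := r0 a 1
    simp only [mul_one, τ1] at this
    simp only [hm, this, Pi.smul_apply, smul_eq_mul]
    simp [hτ, mul_comm]
  have hm1 : ∀ N, m (N + 1) = t (N + 1) • γ + (A * W) *ᵥ m N := by
    intro N
    ext a
    have := r1 N a 1
    simp only [mul_one, τ1] at this
    simp only [hm, this, Pi.smul_apply, Pi.add_apply, smul_eq_mul, Matrix.mulVec, dotProduct,
      Matrix.mul_apply, Finset.sum_mul]
    rw [Finset.sum_comm]
    simp [hτ, mul_comm]
  have hpX : ∀ (a c : V) N, ∑ b, A a b * τ N (pderiv b (X c)) = t N * A a c := by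
    intro a c N
    rw [Finset.sum_eq_single c]
    · simp [τ1, mul_comm]
    · intro b _ hb
      rw [pderiv_X_of_ne (Ne.symm hb)]
      simp [hτ]
    · simp
  have hS0 : S 0 = t 0 • A + Matrix.vecMulVec γ (m 0) := by
    ext a c
    simp only [hS, Matrix.of_apply, r0, hpX, Matrix.add_apply, Matrix.smul_apply, smul_eq_mul,
      Matrix.vecMulVec_apply, hm]
    ring
  have hS1 : ∀ N, S (N + 1) = (t (N + 1) • A + Matrix.vecMulVec γ (m (N + 1))) + (A * W) * S N := by
    intro N
    ext a c
    simp only [hS, Matrix.of_apply, r1, hpX, Matrix.add_apply, Matrix.smul_apply, smul_eq_mul,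
      Matrix.vecMulVec_apply, hm, Matrix.mul_apply, Finset.sum_mul]
    rw [Finset.sum_comm]
    ring
  have em := solve_rec_vec (A * W) m (fun N => t N • γ) hm0 hm1
  have eS := solve_rec_mat (A * W) S (fun N => t N • A + Matrix.vecMulVec γ (m N)) hS0 hS1
  have step : 2 * ((N : R) + 1) * t (N + 1) = Matrix.trace (W * S N) := by
    have : 2 * ((N : R) + 1) * t (N + 1) = τ N (2 * q) := by
      rw [ht, show (2 : MvPolynomial V R) = C 2 from (map_ofNat C 2).symm, τC]
      simp only [hτ, ← hinv N, pow_succ']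
      ring
    rw [this, hq2, τsum]
    simp only [τsum, τC, Matrix.trace, Matrix.diag, Matrix.mul_apply, hS, Matrix.of_apply]
    refine Finset.sum_congr rfl fun b _ => Finset.sum_congr rfl fun c _ => ?_
    rw [mul_comm (X b)]
  have hcomm : ∀ k, W * (A * W) ^ k = (W * A) ^ k * W := by
    intro k
    induction k with
    | zero => simp
    | succ k ih => rw [pow_succ, ← mul_assoc, ih, pow_succ]; simp only [mul_assoc]
  have htr : ∀ k, ((A * W) ^ k)ᵀ = (W * A) ^ k := by
    intro k
    rw [Matrix.transpose_pow, Matrix.transpose_mul, hA.eq, hW.eq]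
  rw [step, eS, Matrix.mul_sum, Matrix.trace_sum]
  set φ : ℕ → R := fun k => γ ⬝ᵥ (((W * A) ^ k * W) *ᵥ γ) with hφ
  have h1 : ∀ k l, Matrix.trace (W * ((A * W) ^ k * (t l • A + Matrix.vecMulVec γ (m l))))
      = Matrix.trace ((W * A) ^ (k + 1)) * t l
        + ∑ r ∈ Finset.HasAntidiagonal.antidiagonal l, t r.2 * φ (r.1 + k) := by
    intro k l
    rw [mul_add, mul_add, Matrix.trace_add, ← mul_assoc, hcomm, ← mul_assoc, hcomm]
    congr 1
    · rw [Matrix.mul_smul, Matrix.trace_smul, mul_assoc, ← pow_succ, smul_eq_mul, mul_comm]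
    · rw [Matrix.mul_vecMulVec, Matrix.trace_vecMulVec, em l, dotProduct_sum]
      refine Finset.sum_congr rfl fun r _ => ?_
      simp only [hφ]
      rw [Matrix.mulVec_smul, dotProduct_smul, smul_eq_mul]
      congr 1
      rw [Matrix.dotProduct_mulVec, ← Matrix.mulVec_transpose, dotProduct_comm, htr,
        Matrix.mulVec_mulVec, ← mul_assoc, ← pow_add]
  simp only [h1, Finset.sum_add_distrib, add_mul, sum_anti_assoc]
  simp only [hφ]

end Recursion

section ExpSeries

variable {R : Type*} [CommRing R]

/-- The coefficient appearing in `fN`, for a general sequence. -/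
def expCoeff (g : ℕ → R) (N : ℕ) : R :=
  Polynomial.coeff
    (∑ j ∈ Finset.range (N + 1),
      Polynomial.C (Ring.inverse ((j.factorial : ℕ) : R)) *
        (∑ k ∈ Finset.Icc 1 N, Polynomial.C (g k) * Polynomial.X ^ k) ^ j) N

/-- The series `∑_{k ≥ 1} g_k η^k`. -/
def gSer (g : ℕ → R) : PowerSeries R := PowerSeries.mk fun k => if k = 0 then 0 else g k

/-- Truncated exponential of `gSer g`. -/
def expSer (g : ℕ → R) (K : ℕ) : PowerSeries R :=
  ∑ j ∈ Finset.range (K + 1), PowerSeries.C (Ring.inverse ((j.factorial : ℕ) : R)) * gSer g ^ j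

lemma coeff_gSer_pow (g : ℕ → R) (j n : ℕ) (h : n < j) :
    PowerSeries.coeff n (gSer g ^ j) = 0 := by
  have h1 : (PowerSeries.X : PowerSeries R) ∣ gSer g := by
    rw [PowerSeries.X_dvd_iff, ← PowerSeries.coeff_zero_eq_constantCoeff_apply]
    simp [gSer]
  exact (PowerSeries.X_pow_dvd_iff.mp (pow_dvd_pow_of_dvd h1 j)) n h

lemma coeff_expSer (g : ℕ → R) (n K : ℕ) (h : n ≤ K) :
    PowerSeries.coeff n (expSer g K) = PowerSeries.coeff n (expSer g n) := by
  induction K, h using Nat.le_induction with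
  | base => rfl
  | succ K hK ih =>
    rw [← ih, expSer, Finset.sum_range_succ, map_add, PowerSeries.coeff_C_mul,
      coeff_gSer_pow g _ _ (by omega), mul_zero, add_zero, expSer]

lemma expCoeff_eq (g : ℕ → R) (N : ℕ) :
    expCoeff g N = PowerSeries.coeff N (expSer g N) := by
  have h1 : (∑ k ∈ Finset.Icc 1 N, Polynomial.C (g k) * Polynomial.X ^ k)
      = PowerSeries.trunc (N + 1) (gSer g) := by
    ext m
    rw [PowerSeries.coeff_trunc, Polynomial.finsetSum_coeff]
    simp only [Polynomial.coeff_C_mul, Polynomial.coeff_X_pow, mul_ite, mul_one, mul_zero]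
    rw [Finset.sum_ite_eq]
    simp only [gSer, PowerSeries.coeff_mk, Finset.mem_Icc]
    split_ifs <;> first | rfl | omega
  rw [expCoeff, expSer, h1, Polynomial.finsetSum_coeff, map_sum]
  refine Finset.sum_congr rfl fun j _ => ?_
  rw [Polynomial.coeff_C_mul, PowerSeries.coeff_C_mul]
  congr 1
  have := congrArg (fun p => Polynomial.coeff p N) (PowerSeries.trunc_trunc_pow (gSer g) (N + 1) j)
  simpa [PowerSeries.coeff_trunc, ← Polynomial.coe_pow] using this

lemma expCoeff_zero (g : ℕ → R) : expCoeff g 0 = 1 := by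
  simp [expCoeff]

lemma expCoeff_rec (hR : ∀ n : ℕ, n ≠ 0 → (n : R) * Ring.inverse (n : R) = 1)
    (g : ℕ → R) (N : ℕ) :
    ((N : R) + 1) * expCoeff g (N + 1) = ∑ p ∈ Finset.HasAntidiagonal.antidiagonal N,
      (((p.1 : R) + 1) * g (p.1 + 1)) * expCoeff g p.2 := by
  have hinv : ∀ N : ℕ, ((N : R) + 1) * Ring.inverse (((N + 1).factorial : ℕ) : R)
      = Ring.inverse ((N.factorial : ℕ) : R) := by
    intro k
    have h4 := hR (k+1).factorial (Nat.factorial_ne_zero _)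
    have h5 := hR k.factorial (Nat.factorial_ne_zero _)
    rw [Nat.factorial_succ] at h4 ⊢
    set x := Ring.inverse (((k+1) * k.factorial : ℕ) : R)
    set y := Ring.inverse ((k.factorial : ℕ) : R)
    push_cast at h4 ⊢
    linear_combination (-x * (k+1)) * h5 + y * h4
  have hd : PowerSeries.derivative R (expSer g (N + 1))
      = PowerSeries.derivative R (gSer g) * expSer g N := by
    rw [expSer, Finset.sum_range_succ', map_add, map_sum, expSer, Finset.mul_sum]
    simp only [pow_zero, mul_one, PowerSeries.derivative_C, add_zero]
    refine Finset.sum_congr rfl fun j _ => ?_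
    rw [Derivation.leibniz, PowerSeries.derivative_C, smul_zero, add_zero,
      PowerSeries.derivative_pow, ← hinv j, smul_eq_mul, map_mul]
    simp
    ring
  have h1 := congrArg (PowerSeries.coeff N) hd
  rw [PowerSeries.coeff_derivative, PowerSeries.coeff_mul, ← expCoeff_eq] at h1
  rw [mul_comm, h1]
  refine Finset.sum_congr rfl fun p hp => ?_
  rw [Finset.HasAntidiagonal.mem_antidiagonal] at hp
  rw [PowerSeries.coeff_derivative, coeff_expSer g p.2 N (by omega), ← expCoeff_eq]
  simp [gSer]
  ring

end ExpSeries

section Master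

open MvPolynomial

variable {ι : Type*} [Fintype ι] [DecidableEq ι] {R : Type*} [CommRing R]

lemma fN_eq_wick (hR : ∀ n : ℕ, n ≠ 0 → (n : R) * Ring.inverse (n : R) = 1)
    (A : Matrix (ι ⊕ ι) (ι ⊕ ι) R) (hA : A.IsSymm) (γ : ι ⊕ ι → R) (z : ι → R)
    (Λ : MvPolynomial (ι ⊕ ι) R →ₗ[R] R) (h1 : Λ 1 = 1)
    (hΛ : ∀ a p, Λ (X a * p) = γ a * Λ p + ∑ b, A a b * Λ (pderiv b p)) (N : ℕ) :
    fN N A γ z = Ring.inverse ((N.factorial : ℕ) : R)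
      * Λ ((∑ i, C (z i) * (X (Sum.inl i) * X (Sum.inr i))) ^ N) := by
  set q : MvPolynomial (ι ⊕ ι) R := ∑ i, C (z i) * (X (Sum.inl i) * X (Sum.inr i)) with hq
  set W : Matrix (ι ⊕ ι) (ι ⊕ ι) R := Dmat z * Xmat ι R with hWdef
  have hWb : W = Matrix.fromBlocks 0 (Matrix.diagonal z) (Matrix.diagonal z) 0 := by
    rw [hWdef, Dmat, Xmat, ← Matrix.fromBlocks_diagonal, Matrix.fromBlocks_multiply]
    simp
  have hW : W.IsSymm := by
    rw [hWb, Matrix.IsSymm, Matrix.fromBlocks_transpose]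
    simp
  have hq1 : ∀ b, pderiv b q = ∑ c, C (W b c) * X c := by
    intro b
    rw [hq, map_sum, Fintype.sum_sum_type, hWb]
    rcases b with b | b
    · simp [pderiv_X, Pi.single_apply, Matrix.diagonal_apply, apply_ite]
    · simp [pderiv_X, Pi.single_apply, Matrix.diagonal_apply, apply_ite]
  have hq2 : 2 * q = ∑ b, ∑ c, C (W b c) * (X b * X c) := by
    simp only [Fintype.sum_sum_type, hWb, hq]
    simp [Matrix.diagonal_apply, apply_ite, two_mul]
    refine Finset.sum_congr rfl fun i _ => by ring
  have hrec := wick_rec hR A W hA hW γ Λ hΛ q hq1 hq2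
    (fun N => Ring.inverse ((N.factorial : ℕ) : R) * Λ (q ^ N)) (fun _ => rfl)
  have hf : ∀ N, fN N A γ z = expCoeff (gfun A γ z) N := fun _ => rfl
  rw [hf]
  induction N using Nat.strong_induction_on with
  | _ N ih =>
    cases N with
    | zero => simp [expCoeff_zero, h1]
    | succ N =>
      have e1 := hrec N
      have e2 := expCoeff_rec hR (gfun A γ z) N
      have hu : (2 * ((N : R) + 1)) * Ring.inverse ((2 * (N + 1) : ℕ) : R) = 1 := by
        have := hR (2 * (N + 1)) (by omega)
        push_cast at this ⊢
        exact this
      have e3 : 2 * ((N : R) + 1) * expCoeff (gfun A γ z) (N + 1)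
          = 2 * ((N : R) + 1) * (Ring.inverse (((N+1).factorial : ℕ) : R) * Λ (q ^ (N+1))) := by
        rw [e1, mul_assoc, e2, Finset.mul_sum]
        refine Finset.sum_congr rfl fun p hp => ?_
        rw [Finset.HasAntidiagonal.mem_antidiagonal] at hp
        rw [ih p.2 (by omega), ← mul_assoc]
        congr 1
        have a1 := hR (2 * (p.1 + 1)) (by omega)
        have a2 := hR 2 (by omega)
        rw [gfun]
        simp only [Nat.add_sub_cancel, ← hWdef]
        set x := Ring.inverse ((2 * (p.1 + 1) : ℕ) : R)
        push_cast at a1 a2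
        linear_combination (Matrix.trace ((W * A) ^ (p.1 + 1))) * a1
          + ((p.1 : R) + 1) * (γ ⬝ᵥ (((W * A) ^ p.1 * W) *ᵥ γ)) * a2
      linear_combination (Ring.inverse ((2 * (N + 1) : ℕ) : R)) * e3
        + (Ring.inverse (((N+1).factorial : ℕ) : R) * Λ (q ^ (N+1))
          - expCoeff (gfun A γ z) (N + 1)) * hu

lemma fN_expand (hR : ∀ n : ℕ, n ≠ 0 → (n : R) * Ring.inverse (n : R) = 1)
    (A : Matrix (ι ⊕ ι) (ι ⊕ ι) R) (hA : A.IsSymm) (γ : ι ⊕ ι → R) (z : ι → R)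
    (Λ : MvPolynomial (ι ⊕ ι) R →ₗ[R] R) (h1 : Λ 1 = 1)
    (hΛ : ∀ a p, Λ (X a * p) = γ a * Λ p + ∑ b, A a b * Λ (pderiv b p)) (N : ℕ) :
    fN N A γ z = ∑ n ∈ Finset.univ.piAntidiag N,
      Ring.inverse ((∏ i, (n i).factorial : ℕ) : R) * ((∏ i, z i ^ n i) *
        Λ (∏ i, (X (Sum.inl i) * X (Sum.inr i)) ^ n i)) := by
  rw [fN_eq_wick hR A hA γ z Λ h1 hΛ, Finset.sum_pow_eq_sum_piAntidiag, map_sum, Finset.mul_sum]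
  refine Finset.sum_congr rfl fun n hn => ?_
  rw [Finset.mem_piAntidiag] at hn
  simp only [mul_pow, Finset.prod_mul_distrib, ← map_pow, ← map_prod]
  have hN := hR N.factorial (Nat.factorial_ne_zero _)
  have hn' := hR (∏ i, (n i).factorial) (Finset.prod_ne_zero_iff.mpr fun i _ => Nat.factorial_ne_zero _)
  have hm := Nat.multinomial_spec Finset.univ n
  rw [hn.1] at hm
  rw [show ((Nat.multinomial Finset.univ n : ℕ) : MvPolynomial (ι ⊕ ι) R)
    = C ((Nat.multinomial Finset.univ n : ℕ) : R) from (map_natCast C _).symm,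
    ← smul_eq_C_mul, map_smul, ← smul_eq_C_mul, map_smul, smul_eq_mul, smul_eq_mul]
  rw [← mul_assoc]
  congr 1
  have hm' : ((∏ i, (n i).factorial : ℕ) : R) * (Nat.multinomial Finset.univ n : R)
      = (N.factorial : R) := by exact_mod_cast congrArg (Nat.cast : ℕ → R) hm
  set x := Ring.inverse ((∏ i, (n i).factorial : ℕ) : R)
  set y := Ring.inverse (N.factorial : R)
  set P := ((∏ i, (n i).factorial : ℕ) : R)
  linear_combination (-y * (Nat.multinomial Finset.univ n : R)) * hn' + x * y * hm' + x * hN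

end Master

section FiniteDifference

open MvPolynomial

/-- The value of the finite difference operator on a power. -/
def dlt (k : ℕ) (u v : ℂ) (n : ℕ) : ℂ :=
  ((u - v) ^ k)⁻¹ * ∑ m ∈ Finset.range (k + 1),
    ((Nat.choose k m : ℂ) * (-1) ^ (k - m)) * (v + (m : ℂ) * (u - v)) ^ n

lemma dlt_aux (k : ℕ) (u v : ℂ) (n : ℕ) :
    ∑ m ∈ Finset.range (k + 1),
      ((Nat.choose k m : ℂ) * (-1) ^ (k - m)) * (v + (m : ℂ) * (u - v)) ^ n
    = ((fwdDiff (1 : ℂ))^[k]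
        (fun x => Polynomial.eval x ((Polynomial.C (u - v) * Polynomial.X + Polynomial.C v) ^ n))) 0 := by
  rw [fwdDiff_iter_eq_sum_shift]
  refine Finset.sum_congr rfl fun m _ => ?_
  simp
  ring

lemma dlt_self (k : ℕ) (u v : ℂ) (h : u ≠ v) : dlt k u v k = (k.factorial : ℂ) := by
  have h0 : u - v ≠ 0 := sub_ne_zero.mpr h
  rw [dlt, dlt_aux]
  set P := (Polynomial.C (u - v) * Polynomial.X + Polynomial.C v) ^ k with hP
  have hd : P.natDegree = k := by
    rw [hP, Polynomial.natDegree_pow, Polynomial.natDegree_linear h0, mul_one]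
  have hl : P.leadingCoeff = (u - v) ^ k := by
    rw [hP, Polynomial.leadingCoeff_pow, Polynomial.leadingCoeff_linear h0]
  have := Polynomial.fwdDiff_iter_degree_eq_factorial P
  rw [hd, hl] at this
  have h2 := congrFun this 0
  erw [h2]
  simp
  field_simp

lemma dlt_lt (k : ℕ) (u v : ℂ) (n : ℕ) (hn : n < k) : dlt k u v n = 0 := by
  rw [dlt, dlt_aux]
  have := Polynomial.fwdDiff_iter_eq_zero_of_degree_lt
    (P := (Polynomial.C (u - v) * Polynomial.X + Polynomial.C v) ^ n) (n := k) (by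
      refine lt_of_le_of_lt (Polynomial.natDegree_pow_le_of_le n
        (Polynomial.natDegree_linear_le)) (by simpa using hn))
  have h2 := congrFun this 0
  erw [h2]
  simp

lemma substVar_monomial {L : ℕ} (j : Fin L) (c : ℂ) (d : Fin L →₀ ℕ) (a : ℂ) :
    substVar j c (monomial d a) = monomial (d.erase j) (a * c ^ d j) := by
  rw [substVar, aeval_monomial, monomial_eq, Finsupp.prod_fintype _ _ (by simp),
    Finsupp.prod_fintype _ _ (by simp), ← Finset.mul_prod_erase Finset.univ _ (Finset.mem_univ j),
    ← Finset.mul_prod_erase Finset.univ (fun i => X i ^ (d.erase j) i) (Finset.mem_univ j)]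
  simp only [if_true, Finsupp.erase_same, pow_zero, one_mul, map_mul, map_pow, algebraMap_eq,
    mul_assoc]
  congr 2
  refine Finset.prod_congr rfl fun i hi => ?_
  have hij : i ≠ j := Finset.ne_of_mem_erase hi
  rw [if_neg hij, Finsupp.erase_ne hij]

lemma fdiff_monomial {L : ℕ} (j : Fin L) (k : ℕ) (u v : ℂ) (d : Fin L →₀ ℕ) (a : ℂ) :
    fdiff j k u v (monomial d a) = monomial (d.erase j) (a * dlt k u v (d j)) := by
  simp only [fdiff, substVar_monomial, C_mul_monomial, dlt]
  rw [← map_sum, C_mul_monomial]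
  congr 1
  simp only [Finset.mul_sum]
  refine Finset.sum_congr rfl fun m _ => by ring

lemma fdiff_add {L : ℕ} (j : Fin L) (k : ℕ) (u v : ℂ) (P Q : MvPolynomial (Fin L) ℂ) :
    fdiff j k u v (P + Q) = fdiff j k u v P + fdiff j k u v Q := by
  simp only [fdiff, substVar, map_add, mul_add, Finset.sum_add_distrib]

lemma fdiff_zero {L : ℕ} (j : Fin L) (k : ℕ) (u v : ℂ) :
    fdiff j k u v (0 : MvPolynomial (Fin L) ℂ) = 0 := by
  simp [fdiff, substVar]

lemma fdiff_sum {L : ℕ} (j : Fin L) (k : ℕ) (u v : ℂ) {β : Type*}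
    (s : Finset β) (P : β → MvPolynomial (Fin L) ℂ) :
    fdiff j k u v (∑ x ∈ s, P x) = ∑ x ∈ s, fdiff j k u v (P x) := by
  induction s using Finset.cons_induction with
  | empty => simp [fdiff_zero]
  | cons x s hx ih => rw [Finset.sum_cons, Finset.sum_cons, fdiff_add, ih]

lemma foldr_sum {L : ℕ} (b : Fin L → ℕ) (u v : Fin L → ℂ) (l : List (Fin L)) {β : Type*}
    (s : Finset β) (P : β → MvPolynomial (Fin L) ℂ) :
    l.foldr (fun j Q => fdiff j (b j) (u j) (v j) Q) (∑ x ∈ s, P x)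
      = ∑ x ∈ s, l.foldr (fun j Q => fdiff j (b j) (u j) (v j) Q) (P x) := by
  induction l with
  | nil => simp
  | cons j l ih =>
    simp only [List.foldr_cons, ih, fdiff_sum]

lemma foldr_monomial {L : ℕ} (b : Fin L → ℕ) (u v : Fin L → ℂ) (d : Fin L →₀ ℕ) (a : ℂ)
    (l : List (Fin L)) (hl : l.Nodup) :
    ∃ d' : Fin L →₀ ℕ, (∀ i, i ∉ l → d' i = d i) ∧ (∀ i, i ∈ l → d' i = 0) ∧
      l.foldr (fun j Q => fdiff j (b j) (u j) (v j) Q) (monomial d a)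
        = monomial d' (a * (l.map fun j => dlt (b j) (u j) (v j) (d j)).prod) := by
  induction l with
  | nil => exact ⟨d, by simp, by simp, by simp⟩
  | cons j l ih =>
    rw [List.nodup_cons] at hl
    obtain ⟨d', h1, h2, h3⟩ := ih hl.2
    refine ⟨d'.erase j, ?_, ?_, ?_⟩
    · intro i hi
      simp only [List.mem_cons, not_or] at hi
      rw [Finsupp.erase_ne hi.1, h1 i hi.2]
    · intro i hi
      by_cases hij : i = j
      · subst hij; simp
      · rw [Finsupp.erase_ne hij]
        exact h2 i (by simpa [hij] using hi)
    · rw [List.foldr_cons, h3, fdiff_monomial, h1 j hl.1, List.map_cons, List.prod_cons]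
      congr 1
      ring

lemma foldr_monomial_full {L : ℕ} (b : Fin L → ℕ) (u v : Fin L → ℂ) (huv : ∀ j, u j ≠ v j)
    (d : Fin L →₀ ℕ) (a : ℂ) (hd : ∑ j, d j = ∑ j, b j) :
    (List.finRange L).foldr (fun j Q => fdiff j (b j) (u j) (v j) Q) (monomial d a)
      = C (if ∀ j, d j = b j then a * ∏ j, ((b j).factorial : ℂ) else 0) := by
  obtain ⟨d', _, h2, h3⟩ := foldr_monomial b u v d a (List.finRange L) (List.nodup_finRange L)
  have hd' : d' = 0 := by ext i; exact h2 i (List.mem_finRange i)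
  rw [h3, hd', ← Fin.prod_univ_def, ← C_apply]
  congr 1
  split_ifs with h
  · congr 1
    refine Finset.prod_congr rfl fun j _ => ?_
    rw [h j, dlt_self _ _ _ (huv j)]
  · have : ∃ j, d j < b j := by
      by_contra hcon
      push Not at hcon
      apply h
      intro j
      exact ((Finset.sum_eq_sum_iff_of_le (fun i _ => hcon i)).mp hd.symm j (Finset.mem_univ j)).symm
    obtain ⟨j, hj⟩ := this
    rw [Finset.prod_eq_zero (Finset.mem_univ j) (dlt_lt _ _ _ _ hj), mul_zero]

end FiniteDifference

section Final

open MvPolynomial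

lemma prod_flatMap_aux {α S : Type*} [CommMonoid S] (g : α → List S) (l : List α) :
    (l.flatMap g).prod = (l.map fun a => (g a).prod).prod := by
  induction l with
  | nil => simp
  | cons a l ih => simp [List.flatMap_cons, ih]

lemma prod_rep {M : ℕ} {S : Type*} [CommMonoid S] (n : Fin M → ℕ) (f : Fin M → S) :
    ∏ i, f (rep n i) = ∏ k, f k ^ n k := by
  have h1 : ∏ i, f (rep n i) = ((repList n).map f).prod := by
    have : ∏ i : Fin (repList n).length, f ((repList n).get i) = ((repList n).map f).prod := by
      rw [← List.prod_ofFn]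
      congr 1
      rw [List.ofFn_comp' , List.ofFn_get]
    rw [← this]
    exact Fintype.prod_equiv (finCongr (repList_length n).symm) _ _ (fun i => rfl)
  rw [h1, repList, List.map_flatMap, prod_flatMap_aux, Fin.prod_univ_def]
  simp

lemma prod_dbl {M : ℕ} {S : Type*} [CommMonoid S] (n : Fin M → ℕ) (f : Fin M ⊕ Fin M → S) :
    ∏ i, f (dbl n n i) = ∏ k, (f (Sum.inl k) * f (Sum.inr k)) ^ n k := by
  have : ∏ i, f (dbl n n i) = ∏ x, f (Sum.map (rep n) (rep n) x) :=
    Fintype.prod_equiv finSumFinEquiv.symm _ _ (fun i => rfl)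
  rw [this, Fintype.prod_sum_type]
  simp only [Sum.map_inl, Sum.map_inr]
  rw [prod_rep n (fun k => f (Sum.inl k)), prod_rep n (fun k => f (Sum.inr k)),
    ← Finset.prod_mul_distrib]
  simp only [mul_pow]

lemma C_lhafv {M : ℕ} {σ : Type*} (A : Matrix (Fin M ⊕ Fin M) (Fin M ⊕ Fin M) ℂ)
    (hA : A.IsSymm) (γ : Fin M ⊕ Fin M → ℂ)
    (Λ : MvPolynomial (Fin M ⊕ Fin M) (MvPolynomial σ ℂ) →ₗ[MvPolynomial σ ℂ] MvPolynomial σ ℂ)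
    (h1 : Λ 1 = 1)
    (hΛ : ∀ a p, Λ (X a * p) = C (γ a) * Λ p + ∑ b, (A.map C) a b * Λ (pderiv b p))
    (n : Fin M → ℕ) :
    C (lhafv (repMat A n n) (repVec γ n n))
      = Λ (∏ i, (X (Sum.inl i) * X (Sum.inr i)) ^ n i) := by
  have hA' : (A.map (C : ℂ →+* MvPolynomial σ ℂ)).IsSymm := hA.map _
  rw [← prod_dbl n (fun x => (X x : MvPolynomial (Fin M ⊕ Fin M) (MvPolynomial σ ℂ))),
    ← lhafS_eq_wick (A.map C) hA' (fun a => C (γ a)) Λ h1 hΛ (dbl n n) _ Finset.univ le_rfl,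
    lhafv, lhaf_eq_lhafS]
  unfold lhafS
  rw [map_sum]
  refine Finset.sum_congr rfl fun σ _ => ?_
  rw [map_prod]
  refine Finset.prod_congr rfl fun i _ => ?_
  rw [apply_ite C, map_one]
  congr 1
  rw [filldiag, Matrix.of_apply, apply_ite C]
  rfl

end Final

/-- Finite-difference formula for the blocked loop Hafnian: regard `f_N(A,γ,z̄)`, with
`z̄_i = w_{π(i)}`, as a polynomial in the variables `w_1,…,w_L`.  Then for any parameters
`u_j ≠ v_j`, `lhaf_Λ(A,γ,b) = (Π_j D_{w_j}^{(b_j)}) f_N(A,γ,z̄)` (the right-hand side is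
a constant polynomial). -/
theorem blocked_lhaf_finite_difference (M L : ℕ) (hM : 1 ≤ M)
    (A : Matrix (Fin M ⊕ Fin M) (Fin M ⊕ Fin M) ℂ) (hA : A.IsSymm)
    (γ : Fin M ⊕ Fin M → ℂ) (π : Fin M → Fin L) (hπ : Function.Surjective π)
    (b : Fin L → ℕ) (u v : Fin L → ℂ) (huv : ∀ j, u j ≠ v j) :
    (List.finRange L).foldr (fun j Q => fdiff j (b j) (u j) (v j) Q)
        (fN (∑ j, b j) (A.map MvPolynomial.C) (fun x => MvPolynomial.C (γ x))
          (fun i => (MvPolynomial.X (π i) : MvPolynomial (Fin L) ℂ)))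
      = MvPolynomial.C (lhafB π A γ b) := by
  set R := MvPolynomial (Fin L) ℂ
  have hinv : ∀ n : ℕ, n ≠ 0 → Ring.inverse ((n : ℕ) : R) = MvPolynomial.C ((n : ℂ)⁻¹) := by
    intro n hn
    have h : ((n : ℕ) : R) * MvPolynomial.C ((n : ℂ)⁻¹) = 1 := by
      rw [← map_natCast (MvPolynomial.C : ℂ →+* R), ← map_mul,
        mul_inv_cancel₀ (by exact_mod_cast hn), map_one]
    have hu : IsUnit ((n : ℕ) : R) := IsUnit.of_mul_eq_one _ h
    have h2 := Ring.inverse_mul_cancel _ hu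
    calc Ring.inverse ((n : ℕ) : R)
        = Ring.inverse ((n : ℕ) : R) * (((n : ℕ) : R) * MvPolynomial.C ((n : ℂ)⁻¹)) := by
          rw [h, mul_one]
      _ = _ := by rw [← mul_assoc, h2, one_mul]
  have hR : ∀ n : ℕ, n ≠ 0 → (n : R) * Ring.inverse (n : R) = 1 := by
    intro n hn
    rw [hinv n hn, ← map_natCast (MvPolynomial.C : ℂ →+* R), ← map_mul,
        mul_inv_cancel₀ (by exact_mod_cast hn), map_one]
  have hA' : (A.map (MvPolynomial.C : ℂ →+* R)).IsSymm := hA.map _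
  obtain ⟨Λ, h1, hΛ⟩ := exists_wick hR (A.map MvPolynomial.C) hA' (fun x => MvPolynomial.C (γ x))
  rw [fN_expand hR _ hA' _ _ Λ h1 hΛ, foldr_sum]
  have hterm : ∀ n ∈ Finset.univ.piAntidiag (∑ j, b j),
      (List.finRange L).foldr (fun j Q => fdiff j (b j) (u j) (v j) Q)
        (Ring.inverse ((∏ i, (n i).factorial : ℕ) : R) *
          ((∏ i, (MvPolynomial.X (π i) : R) ^ n i) *
          Λ (∏ i, (MvPolynomial.X (Sum.inl i) * MvPolynomial.X (Sum.inr i)) ^ n i)))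
      = if (∀ j, ∑ i ∈ Finset.univ.filter (fun i => π i = j), n i = b j) then
          MvPolynomial.C ((∏ j, ((b j).factorial : ℂ)) *
            (lhafv (repMat A n n) (repVec γ n n) / ∏ i, ((n i).factorial : ℂ))) else 0 := by
    intro n hn
    rw [Finset.mem_piAntidiag] at hn
    set d : Fin L →₀ ℕ := ∑ i, Finsupp.single (π i) (n i) with hd
    have hdj : ∀ j, d j = ∑ i ∈ Finset.univ.filter (fun i => π i = j), n i := by
      intro j
      rw [hd, Finsupp.finsetSum_apply, Finset.sum_filter]
      simp [Finsupp.single_apply]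
    have hX : ∏ i, (MvPolynomial.X (π i) : R) ^ n i = MvPolynomial.monomial d 1 := by
      rw [hd, MvPolynomial.monomial_sum_one]
      refine Finset.prod_congr rfl fun i _ => ?_
      rw [MvPolynomial.X_pow_eq_monomial]
    rw [← C_lhafv A hA γ Λ h1 hΛ n, hinv _ (Finset.prod_ne_zero_iff.mpr
      fun i _ => Nat.factorial_ne_zero _), hX, mul_comm (MvPolynomial.monomial d 1),
      MvPolynomial.C_mul_monomial, MvPolynomial.C_mul_monomial, foldr_monomial_full b u v huv]
    · simp only [hdj]
      split_ifs with h
      · congr 1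
        push_cast
        rw [div_eq_mul_inv]
        ring
      · simp
    · rw [← hn.1]
      simp only [hdj]
      exact Finset.sum_fiberwise _ _ _
  rw [Finset.sum_congr rfl hterm, ← Finset.sum_filter, lhafB, Finset.mul_sum, map_sum]
  refine Finset.sum_congr ?_ fun n _ => rfl
  ext n
  simp only [Kset, Finset.mem_filter, Finset.mem_piAntidiag, Fintype.mem_piFinset,
    Finset.mem_range]
  constructor
  · rintro ⟨⟨h1, _⟩, h2⟩
    refine ⟨fun i => ?_, h2⟩
    have := Finset.single_le_sum (f := n) (fun i _ => Nat.zero_le _) (Finset.mem_univ i)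
    have h1' : ∑ x, n x = ∑ j, b j := h1
    omega
  · rintro ⟨_, h2⟩
    refine ⟨⟨?_, by simp⟩, h2⟩
    rw [← Finset.sum_fiberwise Finset.univ π n]
    exact Finset.sum_congr rfl fun j _ => h2 j

end
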